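/- arXiv:2605.01987 — 2 statements merged into one kernel-verified Lean document; each statement's English description precedes it below -/
import Mathlib

section
/- Let G be a simple undirected graph on n vertices with combinatorial Laplacian L, and let Ĝ be obtained by retaining each edge independently with probability p_s ∈ (0,1]. Let f(G) = σ((h₀I + h₁L)x) with σ elementwise C_σ-Lipschitz and ‖x‖₂ = 1, let labels y(G), y(Ĝ) ∈ {±1}ⁿ be obtained by thresholding f at level τ, and assume minimum margin γ_min = min_i |f_i(G) − τ| > 0. Then for every η ∈ (0,1), with probability at least 1 − η, the misclassification rate satisfies R(y(G), y(Ĝ)) ≤ (C_σ|h₁|/(√n · γ_min)) · { (1 − p_s)‖L‖₂ + √(4 p_s (1 − p_s) ‖L‖₂ log(2n/η)) + (4/3) log(2n/η) }. -/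
open MeasureTheory ProbabilityTheory Finset
open scoped Classical

/-- Spectral (ℓ²-operator) norm of a real square matrix. -/
noncomputable def specNorm {n : ℕ} (M : Matrix (Fin n) (Fin n) ℝ) : ℝ :=
  ‖Matrix.toEuclideanCLM (𝕜 := ℝ) M‖

/-- Euclidean (ℓ²) norm of a vector in ℝⁿ. -/
noncomputable def evNorm {n : ℕ} (u : Fin n → ℝ) : ℝ :=
  Real.sqrt (∑ i, (u i) ^ 2)

/-- The rank-one matrix (e_i − e_j)(e_i − e_j)ᵀ, where e_k is the k-th standard basis vector. -/
noncomputable def edgeMat {n : ℕ} (i j : Fin n) : Matrix (Fin n) (Fin n) ℝ :=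
  Matrix.vecMulVec (fun k => (if k = i then (1 : ℝ) else 0) - (if k = j then 1 else 0))
    (fun k => (if k = i then (1 : ℝ) else 0) - (if k = j then 1 else 0))

/-- Combinatorial graph Laplacian L = D − A. -/
noncomputable def lap {n : ℕ} (A : Matrix (Fin n) (Fin n) ℝ) : Matrix (Fin n) (Fin n) ℝ :=
  Matrix.diagonal (fun i => ∑ j, A i j) - A

/-- All index pairs (i, j) with i < j. -/
noncomputable def pairs (n : ℕ) : Finset (Fin n × Fin n) :=
  Finset.univ.filter (fun p => p.1 < p.2)

/-- Laplacian of the edge-subsampled graph: L̂(ω) = Σ_{i<j} A_{ij} B_{ij}(ω) (e_i−e_j)(e_i−e_j)ᵀ. -/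
noncomputable def lapHat {n : ℕ} (A : Matrix (Fin n) (Fin n) ℝ) {Ω : Type*}
    (B : Fin n → Fin n → Ω → ℝ) (ω : Ω) : Matrix (Fin n) (Fin n) ℝ :=
  ∑ p ∈ pairs n, (A p.1 p.2 * B p.1 p.2 ω) • edgeMat p.1 p.2

/-- One-layer GCN output σ((h₀ I + h₁ M) x), with σ applied elementwise. -/
noncomputable def gcnOut {n : ℕ} (σ : ℝ → ℝ) (h0 h1 : ℝ) (x : Fin n → ℝ)
    (M : Matrix (Fin n) (Fin n) ℝ) : Fin n → ℝ :=
  fun i => σ (((h0 • (1 : Matrix (Fin n) (Fin n) ℝ) + h1 • M).mulVec x) i)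

/-- ±1 labels by thresholding at level τ. -/
noncomputable def thLabels {n : ℕ} (f : Fin n → ℝ) (τ : ℝ) : Fin n → ℝ :=
  fun i => if τ < f i then 1 else -1

/-- Hamming distance between two label vectors. -/
noncomputable def ham {n : ℕ} (y z : Fin n → ℝ) : ℕ :=
  (Finset.univ.filter (fun i => y i ≠ z i)).card

/-- Centered edge-subsampling matrix Y_{ij} = A_{ij}(B_{ij} − p_s)(e_i−e_j)(e_i−e_j)ᵀ. -/
noncomputable def Ymat {n : ℕ} (A : Matrix (Fin n) (Fin n) ℝ) (ps : ℝ) {Ω : Type*}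
    (B : Fin n → Fin n → Ω → ℝ) (i j : Fin n) (ω : Ω) : Matrix (Fin n) (Fin n) ℝ :=
  (A i j * (B i j ω - ps)) • edgeMat i j

/-- The matrix X_{ij} = A_{ij}(B_{ij} − 1)(e_i−e_j)(e_i−e_j)ᵀ. -/
noncomputable def Xmat {n : ℕ} (A : Matrix (Fin n) (Fin n) ℝ) {Ω : Type*}
    (B : Fin n → Fin n → Ω → ℝ) (i j : Fin n) (ω : Ω) : Matrix (Fin n) (Fin n) ℝ :=
  (A i j * (B i j ω - 1)) • edgeMat i j

/-- Entrywise expectation of a random matrix. -/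
noncomputable def matExp {n : ℕ} {Ω : Type*} [MeasurableSpace Ω] (μ : Measure Ω)
    (M : Ω → Matrix (Fin n) (Fin n) ℝ) : Matrix (Fin n) (Fin n) ℝ :=
  Matrix.of fun k l => ∫ ω, M ω k l ∂μ

/-- The single-subsample misclassification bound f(p_s, η). -/
noncomputable def fBound {n : ℕ} (L : Matrix (Fin n) (Fin n) ℝ) (Cσ h1 γmin ps η : ℝ) : ℝ :=
  Cσ * |h1| / (Real.sqrt n * γmin) *
    ((1 - ps) * specNorm L
      + Real.sqrt (4 * ps * (1 - ps) * specNorm L * Real.log (2 * n / η))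
      + 4 / 3 * Real.log (2 * n / η))

/-- Coordinatewise majority vote of m label vectors. -/
noncomputable def majority {n : ℕ} (m : ℕ) (ys : ℕ → Fin n → ℝ) : Fin n → ℝ :=
  fun i => if (m : ℝ) < 2 * (((Finset.range m).filter (fun ℓ => ys ℓ i = 1)).card : ℝ)
    then 1 else -1


lemma cosh_conv (a b c d : ℝ) (hc : |c| ≤ 1) (hd : d ^ 2 = a ^ 2 + b ^ 2 + 2 * (c * a * b)) :
    Real.cosh d ≤ Real.cosh a * Real.cosh b + c * (Real.sinh a * Real.sinh b) := by
  have e1 := abs_le.1 hc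
  have key : Real.cosh d ≤ (1 + c) / 2 * Real.cosh (a + b) + (1 - c) / 2 * Real.cosh (a - b) := by
    refine hasSum_le (fun k => ?_) (Real.hasSum_cosh d)
      (((Real.hasSum_cosh (a + b)).mul_left ((1 + c) / 2)).add
        ((Real.hasSum_cosh (a - b)).mul_left ((1 - c) / 2)))
    have hx : (a + b) ^ 2 ∈ Set.Ici (0 : ℝ) := sq_nonneg (a + b)
    have hy : (a - b) ^ 2 ∈ Set.Ici (0 : ℝ) := sq_nonneg (a - b)
    have w1 : 0 ≤ (1 + c) / 2 := by linarith
    have w2 : 0 ≤ (1 - c) / 2 := by linarith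
    have h := (convexOn_pow (𝕜 := ℝ) k).2 hx hy w1 w2 (by ring)
    simp only [smul_eq_mul] at h
    have h2 : (1 + c) / 2 * (a + b) ^ 2 + (1 - c) / 2 * (a - b) ^ 2 = d ^ 2 := by
      rw [hd]; ring
    rw [h2] at h
    rw [pow_mul, pow_mul, pow_mul, ← mul_div_assoc, ← mul_div_assoc, ← add_div]
    gcongr
  rw [Real.cosh_add, Real.cosh_sub] at key
  linarith

lemma exp_bern {y c : ℝ} (hy : 0 ≤ y) (hyc : y ≤ c) (hc : c < 3) :
    Real.exp y ≤ 1 + y + 1 / (2 * (1 - c / 3)) * y ^ 2 := by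
  have h1 : HasSum (fun k : ℕ => y ^ k / (k.factorial : ℝ)) (Real.exp y) := by
    rw [Real.exp_eq_exp_ℝ]; exact NormedSpace.expSeries_div_hasSum_exp y
  have h2 := (hasSum_nat_add_iff' 2).2 h1
  have h3 := (hasSum_geometric_of_lt_one (r := y / 3) (by positivity) (by linarith)).mul_left (y ^ 2 / 2)
  have h4 := hasSum_le (fun k => ?_) h2 h3
  · simp [Finset.sum_range_succ] at h4
    have h5 : y ^ 2 / 2 * (1 - y / 3)⁻¹ ≤ 1 / (2 * (1 - c / 3)) * y ^ 2 := by
      have : (1 - y / 3)⁻¹ ≤ (1 - c / 3)⁻¹ := by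
        apply inv_anti₀ <;> linarith
      have e : 1 / (2 * (1 - c / 3)) * y ^ 2 = y ^ 2 / 2 * (1 - c / 3)⁻¹ := by
        rw [one_div, mul_inv]; ring
      rw [e]; gcongr
    linarith
  · have h := Nat.factorial_mul_pow_le_factorial (m := 2) (n := k)
    have h' : (2 : ℝ) * 3 ^ k ≤ ((k + 2).factorial : ℝ) := by
      rw [add_comm k 2]; exact_mod_cast h
    have e : y ^ 2 / 2 * (y / 3) ^ k = y ^ (k + 2) / (2 * 3 ^ k) := by
      rw [div_pow, pow_add]; field_simp
    rw [e]; gcongr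

lemma step_bound {E : Type*} [NormedAddCommGroup E] [InnerProductSpace ℝ E]
    (p K : ℝ) (hp0 : 0 ≤ p) (hp1 : p ≤ 1) (s w : E)
    (hK : ∀ y, 0 ≤ y → y ≤ ‖w‖ → Real.exp y ≤ 1 + y + K * y ^ 2) :
    p * Real.cosh ‖s + (1 - p) • w‖ + (1 - p) * Real.cosh ‖s + (-p) • w‖ ≤
      Real.cosh ‖s‖ * (1 + K * (p * (1 - p) * ‖w‖ ^ 2)) := by
  obtain ⟨c, hc1, hc⟩ : ∃ c : ℝ, |c| ≤ 1 ∧ inner ℝ s w = c * ‖s‖ * ‖w‖ := by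
    refine ⟨inner ℝ s w / (‖s‖ * ‖w‖), abs_real_inner_div_norm_mul_norm_le_one s w, ?_⟩
    by_cases h : ‖s‖ * ‖w‖ = 0
    · have := abs_real_inner_le_norm s w
      rw [h] at this
      rw [abs_nonpos_iff.1 this]; simp
    · rw [mul_assoc, div_mul_cancel₀ _ h]
  set a := ‖s‖ with ha
  set b := ‖w‖ with hb
  have hb0 : 0 ≤ b := norm_nonneg _
  have ha0 : 0 ≤ a := norm_nonneg _
  have hq : 0 ≤ 1 - p := by linarith
  have n1 := cosh_conv a ((1 - p) * b) c ‖s + (1 - p) • w‖ hc1 (by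
    rw [norm_add_sq_real, norm_smul, inner_smul_right, hc, Real.norm_eq_abs, abs_of_nonneg hq]; ring)
  have n2 := cosh_conv a (p * b) (-c) ‖s + (-p) • w‖ (by rwa [abs_neg]) (by
    rw [norm_add_sq_real, norm_smul, inner_smul_right, hc, norm_neg, Real.norm_eq_abs,
      abs_of_nonneg hp0]; ring)
  have s1 : (1 - p) * b ≤ Real.sinh ((1 - p) * b) := Real.self_le_sinh_iff.2 (by positivity)
  have s2 : p * b ≤ Real.sinh (p * b) := Real.self_le_sinh_iff.2 (by positivity)
  have k1 := hK ((1 - p) * b) (by positivity) (by nlinarith)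
  have k2 := hK (p * b) (by positivity) (by nlinarith)
  rw [← Real.cosh_add_sinh] at k1 k2
  set S1 := Real.sinh ((1 - p) * b)
  set S2 := Real.sinh (p * b)
  set C1 := Real.cosh ((1 - p) * b)
  set C2 := Real.cosh (p * b)
  have hsa : 0 ≤ Real.sinh a := Real.sinh_nonneg_iff.2 ha0
  have hsc : Real.sinh a ≤ Real.cosh a := (Real.sinh_lt_cosh a).le
  have hcs : |c * Real.sinh a| ≤ Real.cosh a := by
    rw [abs_mul, abs_of_nonneg hsa]
    nlinarith [abs_nonneg c]
  obtain ⟨hcs1, hcs2⟩ := abs_le.1 hcs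
  have u1 : p * ((c * Real.sinh a) * (S1 - (1 - p) * b)) ≤ p * (Real.cosh a * (S1 - (1 - p) * b)) :=
    mul_le_mul_of_nonneg_left (mul_le_mul_of_nonneg_right hcs2 (by linarith)) hp0
  have u2 : (1 - p) * ((-(c * Real.sinh a)) * (S2 - p * b)) ≤
      (1 - p) * (Real.cosh a * (S2 - p * b)) :=
    mul_le_mul_of_nonneg_left (mul_le_mul_of_nonneg_right (by linarith) (by linarith)) hq
  have hca : 0 ≤ Real.cosh a := (Real.cosh_pos a).le
  have v1 := mul_le_mul_of_nonneg_left k1 (mul_nonneg hp0 hca)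
  have v2 := mul_le_mul_of_nonneg_left k2 (mul_nonneg hq hca)
  have m1 := mul_le_mul_of_nonneg_left n1 hp0
  have m2 := mul_le_mul_of_nonneg_left n2 hq
  linarith

lemma bern_int {Ω : Type*} [MeasurableSpace Ω] (μ : Measure Ω) [IsProbabilityMeasure μ]
    (p : ℝ) (hp0 : 0 ≤ p) (B : Ω → ℝ) (hm : Measurable B)
    (h01 : ∀ ω, B ω = 0 ∨ B ω = 1) (hp : μ {ω | B ω = 1} = ENNReal.ofReal p) :
    ∫ ω, B ω ∂μ = p := by
  have : B = Set.indicator {ω | B ω = 1} 1 := by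
    ext ω
    rcases h01 ω with h | h <;> simp [Set.indicator, h]
  have hms : MeasurableSet {ω | B ω = 1} := hm (measurableSet_singleton 1)
  have h2 := integral_indicator_one (μ := μ) hms
  rw [← this] at h2
  rw [h2]
  simp [Measure.real, hp, hp0]

lemma vec_mgf {ι Ω : Type*} [MeasurableSpace Ω] (μ : Measure Ω) [IsProbabilityMeasure μ]
    {n : ℕ} (p K : ℝ) (hp0 : 0 ≤ p) (hp1 : p ≤ 1) (B : ι → Ω → ℝ)
    (hm : ∀ e, Measurable (B e)) (h01 : ∀ e ω, B e ω = 0 ∨ B e ω = 1)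
    (hp : ∀ e, μ {ω | B e ω = 1} = ENNReal.ofReal p) (hind : iIndepFun B μ)
    (w : ι → EuclideanSpace ℝ (Fin n))
    (hK : ∀ e, ∀ y, 0 ≤ y → y ≤ ‖w e‖ → Real.exp y ≤ 1 + y + K * y ^ 2) (T : Finset ι) :
    Integrable (fun ω => Real.cosh ‖∑ e ∈ T, (B e ω - p) • w e‖) μ ∧
    ∫ ω, Real.cosh ‖∑ e ∈ T, (B e ω - p) • w e‖ ∂μ ≤
      Real.exp (K * (p * (1 - p) * ∑ e ∈ T, ‖w e‖ ^ 2)) := by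
  have hIntg : ∀ (T : Finset ι) (z : EuclideanSpace ℝ (Fin n)),
      Integrable (fun ω => Real.cosh ‖(∑ e ∈ T, (B e ω - p) • w e) + z‖) μ := by
    intro T z
    refine Integrable.of_bound (C := Real.cosh ((∑ e ∈ T, ‖w e‖) + ‖z‖)) ?_ (ae_of_all _ fun ω => ?_)
    · apply Measurable.aestronglyMeasurable
      apply Real.continuous_cosh.measurable.comp
      apply Measurable.norm
      apply Measurable.add_const
      exact Finset.measurable_fun_sum _ fun e _ => ((hm e).sub_const p).smul_const _
    · rw [Real.norm_eq_abs, abs_of_nonneg (Real.cosh_pos _).le, Real.cosh_le_cosh,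
        abs_of_nonneg (norm_nonneg _), abs_of_nonneg (by positivity)]
      refine (norm_add_le _ _).trans ?_
      gcongr
      refine norm_sum_le_of_le _ fun e _ => ?_
      rw [norm_smul]
      have : ‖B e ω - p‖ ≤ 1 := by
        rw [Real.norm_eq_abs, abs_le]
        rcases h01 e ω with h | h <;> rw [h] <;> constructor <;> linarith
      nlinarith [norm_nonneg (w e)]
  refine ⟨by simpa using hIntg T 0, ?_⟩
  induction T using Finset.induction_on with
  | empty => simp
  | insert i T hi ih =>
    set S : Ω → EuclideanSpace ℝ (Fin n) := fun ω => ∑ e ∈ T, (B e ω - p) • w e with hS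
    have hindS : IndepFun S (B i) μ := by
      have h := hind.indepFun_finset T {i} (Finset.disjoint_singleton_right.2 hi) hm
      have h' := h.comp (φ := fun v : T → ℝ => ∑ e : T, (v e - p) • w e)
        (ψ := fun v : ({i} : Finset ι) → ℝ => v ⟨i, Finset.mem_singleton_self i⟩)
        (Finset.measurable_fun_sum _ fun e _ =>
          ((measurable_pi_apply (X := fun _ : T => ℝ) e).sub_const p).smul_const (w e))
        (measurable_pi_apply (X := fun _ : ({i} : Finset ι) => ℝ) _)
      have e1 : (fun v : T → ℝ => ∑ e : T, (v e - p) • w e) ∘ (fun a (i : T) ↦ B i a) = S := by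
        ext1 ω
        simp only [Function.comp, hS]
        exact Finset.sum_coe_sort T (fun e => (B e ω - p) • w e)
      rw [e1] at h'
      exact h'
    have hBi := bern_int μ p hp0 (B i) (hm i) (h01 i) (hp i)
    have hBI : Integrable (B i) μ := by
      refine Integrable.of_bound (C := 1) (hm i).aestronglyMeasurable (ae_of_all _ fun ω => ?_)
      rcases h01 i ω with h | h <;> simp [h]
    have hprod : ∀ z : EuclideanSpace ℝ (Fin n),
        Integrable (fun ω => Real.cosh ‖S ω + z‖ * B i ω) μ ∧
        ∫ ω, Real.cosh ‖S ω + z‖ * B i ω ∂μ = (∫ ω, Real.cosh ‖S ω + z‖ ∂μ) * p := by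
      intro z
      have hI : IndepFun (fun ω => Real.cosh ‖S ω + z‖) (B i) μ :=
        hindS.comp (φ := fun v => Real.cosh ‖v + z‖) (ψ := id)
          (Real.continuous_cosh.measurable.comp (measurable_id.add_const z).norm) measurable_id
      refine ⟨hI.integrable_mul (hIntg T z) hBI, ?_⟩
      rw [← hBi]
      exact hI.integral_fun_mul_eq_mul_integral (hIntg T z).aestronglyMeasurable
        hBI.aestronglyMeasurable
    have e2 : ∀ ω, Real.cosh ‖∑ e ∈ insert i T, (B e ω - p) • w e‖ =
        Real.cosh ‖S ω + (1 - p) • w i‖ * B i ω + (Real.cosh ‖S ω + (-p) • w i‖ -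
          Real.cosh ‖S ω + (-p) • w i‖ * B i ω) := by
      intro ω
      rw [Finset.sum_insert hi, add_comm]
      rcases h01 i ω with h | h <;> simp [h, hS]
    simp_rw [e2]
    have hIntg' : ∀ z, Integrable (fun ω => Real.cosh ‖S ω + z‖) μ := fun z => hIntg T z
    have hsubI : Integrable (fun ω => Real.cosh ‖S ω + (-p) • w i‖ -
          Real.cosh ‖S ω + (-p) • w i‖ * B i ω) μ := (hIntg' _).sub (hprod _).1
    rw [integral_add (hprod _).1 hsubI,
      integral_sub (hIntg' _) (hprod _).1, (hprod _).2, (hprod _).2]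
    have e3 : (∫ ω, Real.cosh ‖S ω + (1 - p) • w i‖ ∂μ) * p +
        ((∫ ω, Real.cosh ‖S ω + (-p) • w i‖ ∂μ) - (∫ ω, Real.cosh ‖S ω + (-p) • w i‖ ∂μ) * p) =
        ∫ ω, (p * Real.cosh ‖S ω + (1 - p) • w i‖ + (1 - p) * Real.cosh ‖S ω + (-p) • w i‖) ∂μ := by
      rw [integral_add ((hIntg' _).const_mul _) ((hIntg' _).const_mul _), integral_const_mul,
        integral_const_mul]
      ring
    rw [e3]
    have hI0 : Integrable (fun ω => Real.cosh ‖S ω‖) μ := by simpa using hIntg T 0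
    have e4 := integral_mono (μ := μ)
      (((hIntg T ((1 - p) • w i)).const_mul p).add ((hIntg T ((-p) • w i)).const_mul (1 - p)))
      (hI0.mul_const (1 + K * (p * (1 - p) * ‖w i‖ ^ 2)))
      (fun ω => step_bound p K hp0 hp1 (S ω) (w i) (hK i))
    refine e4.trans ?_
    rw [integral_mul_const, Finset.sum_insert hi]
    have e5 : K * (p * (1 - p) * (‖w i‖ ^ 2 + ∑ e ∈ T, ‖w e‖ ^ 2)) =
        K * (p * (1 - p) * ∑ e ∈ T, ‖w e‖ ^ 2) + K * (p * (1 - p) * ‖w i‖ ^ 2) := by ring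
    rw [e5, Real.exp_add]
    have hexp := Real.add_one_le_exp (K * (p * (1 - p) * ‖w i‖ ^ 2))
    have hn0 : 0 ≤ ∫ ω, Real.cosh ‖S ω‖ ∂μ := integral_nonneg fun ω => (Real.cosh_pos _).le
    calc (∫ ω, Real.cosh ‖S ω‖ ∂μ) * (1 + K * (p * (1 - p) * ‖w i‖ ^ 2))
        ≤ (∫ ω, Real.cosh ‖S ω‖ ∂μ) * Real.exp (K * (p * (1 - p) * ‖w i‖ ^ 2)) :=
          mul_le_mul_of_nonneg_left (by linarith) hn0
      _ ≤ _ := mul_le_mul_of_nonneg_right ih (Real.exp_pos _).le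

lemma choose_lam (V l : ℝ) (hV : 0 ≤ V) (hl : 0 < l) :
    ∃ r : ℝ, 0 < r ∧ 2 * r < 3 ∧
      l ≤ r * (Real.sqrt (2 * V * l) + 4 / 3 * l) - 1 / (2 * (1 - 2 * r / 3)) * (r ^ 2 * V) := by
  rcases hV.eq_or_lt with h | h
  · subst h
    exact ⟨3 / 4, by norm_num, by norm_num, by simp; linarith⟩
  · set q := Real.sqrt (2 * l / V) with hq
    have hq0 : 0 < q := Real.sqrt_pos.2 (by positivity)
    have hq2 : q ^ 2 * V = 2 * l := by
      rw [hq, Real.sq_sqrt (by positivity)]; field_simp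
    have hs : Real.sqrt (2 * V * l) = q * V := by
      rw [Real.sqrt_eq_iff_mul_self_eq (by positivity) (by positivity)]
      linear_combination (-V) * hq2
    refine ⟨q / (1 + 2 / 3 * q), by positivity, ?_, ?_⟩
    · rw [mul_div_assoc', div_lt_iff₀ (by positivity)]; linarith
    · rw [hs]
      have e : 1 - 2 * (q / (1 + 2 / 3 * q)) / 3 = 1 / (1 + 2 / 3 * q) := by field_simp; ring
      rw [e]
      have hl' : l = q ^ 2 * V / 2 := by linarith
      have : q / (1 + 2 / 3 * q) * (q * V + 4 / 3 * l) -
          1 / (2 * (1 / (1 + 2 / 3 * q))) * ((q / (1 + 2 / 3 * q)) ^ 2 * V)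
          = l + (2 / 3 * q * l) / (1 + 2 / 3 * q) := by
        rw [hl']; field_simp; ring
      rw [this]
      have : 0 ≤ (2 / 3 * q * l) / (1 + 2 / 3 * q) := by positivity
      linarith

lemma vec_tail {ι Ω : Type*} [MeasurableSpace Ω] (μ : Measure Ω) [IsProbabilityMeasure μ]
    {n : ℕ} (p : ℝ) (hp0 : 0 ≤ p) (hp1 : p ≤ 1) (B : ι → Ω → ℝ)
    (hm : ∀ e, Measurable (B e)) (h01 : ∀ e ω, B e ω = 0 ∨ B e ω = 1)
    (hp : ∀ e, μ {ω | B e ω = 1} = ENNReal.ofReal p) (hind : iIndepFun B μ)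
    (w : ι → EuclideanSpace ℝ (Fin n)) (hw : ∀ e, ‖w e‖ ≤ 2) (T : Finset ι) (V l : ℝ)
    (hV : p * (1 - p) * ∑ e ∈ T, ‖w e‖ ^ 2 ≤ V) (hl : 0 < l) :
    μ {ω | Real.sqrt (2 * V * l) + 4 / 3 * l < ‖∑ e ∈ T, (B e ω - p) • w e‖} ≤
      ENNReal.ofReal (2 * Real.exp (-l)) := by
  have hV0 : 0 ≤ V := by
    refine le_trans ?_ hV
    have : 0 ≤ 1 - p := by linarith
    positivity
  obtain ⟨r, hr0, hr3, hr⟩ := choose_lam V l hV0 hl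
  set t := Real.sqrt (2 * V * l) + 4 / 3 * l with ht
  set K := 1 / (2 * (1 - 2 * r / 3)) with hKdef
  have hK0 : 0 ≤ K := by
    apply div_nonneg zero_le_one; linarith
  obtain ⟨hi, hb⟩ := vec_mgf μ p K hp0 hp1 B hm h01 hp hind (fun e => r • w e) (fun e y hy hyw => by
    refine exp_bern hy (hyw.trans ?_) hr3
    rw [norm_smul, Real.norm_eq_abs, abs_of_pos hr0]
    nlinarith [hw e]) T
  have hsum : ∀ ω, ‖∑ e ∈ T, (B e ω - p) • r • w e‖ = r * ‖∑ e ∈ T, (B e ω - p) • w e‖ := by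
    intro ω
    simp_rw [smul_comm _ r]
    rw [← Finset.smul_sum, norm_smul, Real.norm_eq_abs, abs_of_pos hr0]
  simp_rw [hsum] at hi hb
  have hmk := mul_meas_ge_le_integral_of_nonneg (ae_of_all μ fun ω => (Real.cosh_pos _).le) hi
    (Real.exp (r * t) / 2)
  have hsub : {ω | t < ‖∑ e ∈ T, (B e ω - p) • w e‖} ⊆
      {ω | Real.exp (r * t) / 2 ≤ Real.cosh (r * ‖∑ e ∈ T, (B e ω - p) • w e‖)} := by
    intro ω hω
    simp only [Set.mem_ofPred_eq] at hω ⊢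
    have h1 : Real.exp (r * t) ≤ Real.exp (r * ‖∑ e ∈ T, (B e ω - p) • w e‖) :=
      Real.exp_le_exp.2 (mul_le_mul_of_nonneg_left hω.le hr0.le)
    rw [Real.cosh_eq]
    have := Real.exp_pos (-(r * ‖∑ e ∈ T, (B e ω - p) • w e‖))
    linarith
  refine (measure_mono hsub).trans ?_
  rw [← ENNReal.ofReal_toReal (measure_ne_top μ _)]
  apply ENNReal.ofReal_le_ofReal
  have hE : K * (p * (1 - p) * ∑ e ∈ T, ‖r • w e‖ ^ 2) ≤ r * t - l := by
    have : p * (1 - p) * ∑ e ∈ T, ‖r • w e‖ ^ 2 = r ^ 2 * (p * (1 - p) * ∑ e ∈ T, ‖w e‖ ^ 2) := by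
      simp_rw [norm_smul, mul_pow, Real.norm_eq_abs, sq_abs]
      rw [← Finset.mul_sum]; ring
    rw [this]
    have := mul_le_mul_of_nonneg_left (mul_le_mul_of_nonneg_left hV (sq_nonneg r)) hK0
    linarith
  have h3 := hmk.trans (hb.trans (Real.exp_le_exp.2 hE))
  rw [sub_eq_add_neg, Real.exp_add] at h3
  have hpos := Real.exp_pos (r * t)
  change μ.real _ ≤ _
  have h4 : Real.exp (r * t) * (μ.real {ω | Real.exp (r * t) / 2 ≤
      Real.cosh (r * ‖∑ e ∈ T, (B e ω - p) • w e‖)}) ≤ Real.exp (r * t) * (2 * Real.exp (-l)) := by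
    linarith
  exact le_of_mul_le_mul_left h4 hpos

lemma le_sq_aux {a b : ℝ} (h : a ^ 2 ≤ b ^ 2) (hb : 0 ≤ b) : a ≤ b := (abs_le.1 (abs_le_of_sq_le_sq h hb)).2

lemma sum_sym_pairs {n : ℕ} (f : Fin n → Fin n → ℝ) (hs : ∀ i j, f i j = f j i)
    (h0 : ∀ i, f i i = 0) : ∑ i, ∑ j, f i j = 2 * ∑ q ∈ pairs n, f q.1 q.2 := by
  have h1 : ∑ q ∈ pairs n, f q.1 q.2 = ∑ i, ∑ j, if i < j then f i j else 0 := by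
    rw [pairs, Finset.sum_filter, ← Finset.univ_product_univ, Finset.sum_product]
  have h2 : ∑ i, ∑ j, (if j < i then f i j else 0) = ∑ i, ∑ j, if i < j then f i j else 0 := by
    rw [Finset.sum_comm]
    refine Finset.sum_congr rfl fun i _ => Finset.sum_congr rfl fun j _ => ?_
    rw [hs]
  rw [h1, two_mul]
  nth_rewrite 1 [← h2]
  simp_rw [← Finset.sum_add_distrib]
  refine Finset.sum_congr rfl fun i _ => Finset.sum_congr rfl fun j _ => ?_
  rcases lt_trichotomy i j with h | h | h
  · simp [h, h.not_gt]
  · subst h; simp [h0]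
  · simp [h, h.not_gt]

lemma lap_eq_sum {n : ℕ} (A : Matrix (Fin n) (Fin n) ℝ) (hAsymm : A.IsSymm)
    (hAdiag : ∀ i, A i i = 0) : lap A = ∑ q ∈ pairs n, A q.1 q.2 • edgeMat q.1 q.2 := by
  ext k l
  have hs : ∀ i j, A i j = A j i := fun i j => (hAsymm.apply i j).symm
  have h := sum_sym_pairs (fun i j => A i j * edgeMat i j k l)
    (fun i j => by
      simp only [edgeMat, Matrix.vecMulVec_apply]
      rw [hs i j]; ring) (fun i => by simp [hAdiag])
  rw [Matrix.sum_apply]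
  simp only [Matrix.smul_apply, smul_eq_mul]
  have h2 : ∑ i, ∑ j, A i j * edgeMat i j k l = 2 * lap A k l := by
    simp only [edgeMat, Matrix.vecMulVec_apply, mul_sub, sub_mul, Finset.sum_sub_distrib, lap,
      Matrix.sub_apply, Matrix.diagonal_apply, mul_ite, ite_mul, mul_one, mul_zero, zero_mul, one_mul]
    by_cases hkl : k = l
    · subst hkl
      simp [hAdiag]
      rw [two_mul]; congr 1; exact Finset.sum_congr rfl fun i _ => hs i k
    · have hlk : ¬ l = k := fun h => hkl h.symm
      simp [hkl, hlk, hs l k]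
      ring_nf
  linarith

/-- The vector attached to an edge. -/
noncomputable def edgeVec {n : ℕ} (A : Matrix (Fin n) (Fin n) ℝ) (x : Fin n → ℝ)
    (i j : Fin n) : EuclideanSpace ℝ (Fin n) :=
  WithLp.toLp 2 ((A i j • edgeMat i j).mulVec x)

lemma edgeMat_mulVec {n : ℕ} (i j : Fin n) (x : Fin n → ℝ) (k : Fin n) :
    (edgeMat i j).mulVec x k =
      (x i - x j) * ((if k = i then (1 : ℝ) else 0) - (if k = j then 1 else 0)) := by
  simp only [Matrix.mulVec, dotProduct, edgeMat, Matrix.vecMulVec_apply]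
  simp_rw [mul_assoc]
  rw [← Finset.mul_sum, mul_comm]
  simp [sub_mul, Finset.sum_sub_distrib]

lemma edgeVec_norm_sq {n : ℕ} (A : Matrix (Fin n) (Fin n) ℝ) (hA01 : ∀ i j, A i j = 0 ∨ A i j = 1)
    (x : Fin n → ℝ) (i j : Fin n) (hij : i ≠ j) :
    ‖edgeVec A x i j‖ ^ 2 = 2 * (A i j * (x i - x j) ^ 2) := by
  rw [EuclideanSpace.norm_sq_eq]
  simp only [edgeVec, Matrix.smul_mulVec, Pi.smul_apply, smul_eq_mul, edgeMat_mulVec,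
    Real.norm_eq_abs, sq_abs, mul_pow]
  rw [← Finset.mul_sum, ← Finset.mul_sum]
  have h : ∑ k, ((if k = i then (1 : ℝ) else 0) - (if k = j then 1 else 0)) ^ 2 = 2 := by
    have h' : ∀ k, ((if k = i then (1 : ℝ) else 0) - (if k = j then 1 else 0)) ^ 2 =
        (if k = i then (1 : ℝ) else 0) + (if k = j then 1 else 0) := by
      intro k
      by_cases h1 : k = i
      · subst h1; simp [hij]
      · by_cases h2 : k = j
        · subst h2; simp [h1]
        · simp [h1, h2]
    simp_rw [h', Finset.sum_add_distrib]
    simp; norm_num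
  rw [h]
  rcases hA01 i j with h | h <;> simp [h]; ring

lemma evNorm_eq {n : ℕ} (x : Fin n → ℝ) : evNorm x = ‖(WithLp.toLp 2 x : EuclideanSpace ℝ (Fin n))‖ := by
  simp [evNorm, EuclideanSpace.norm_eq]

lemma quad_le {n : ℕ} (A : Matrix (Fin n) (Fin n) ℝ) (hAsymm : A.IsSymm)
    (hAdiag : ∀ i, A i i = 0) (x : Fin n → ℝ) (hx : evNorm x = 1) :
    ∑ q ∈ pairs n, A q.1 q.2 * (x q.1 - x q.2) ^ 2 ≤ specNorm (lap A) := by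
  rw [evNorm_eq] at hx
  set X : EuclideanSpace ℝ (Fin n) := WithLp.toLp 2 x with hX
  have h1 : inner ℝ X (Matrix.toEuclideanCLM (𝕜 := ℝ) (lap A) X) =
      ∑ q ∈ pairs n, A q.1 q.2 * (x q.1 - x q.2) ^ 2 := by
    rw [Matrix.inner_toEuclideanCLM, lap_eq_sum A hAsymm hAdiag, Matrix.sum_mulVec, dotProduct_sum]
    refine Finset.sum_congr rfl fun q _ => ?_
    rw [Matrix.smul_mulVec, dotProduct_smul, smul_eq_mul]
    congr 1
    simp only [dotProduct, hX, edgeMat_mulVec]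
    simp_rw [mul_left_comm (x _)]
    rw [← Finset.mul_sum, sq]
    congr 1
    simp [mul_sub, Finset.sum_sub_distrib]
  rw [← h1]
  refine (real_inner_le_norm _ _).trans ?_
  rw [hx, one_mul]
  refine (ContinuousLinearMap.le_opNorm _ _).trans ?_
  rw [hx, mul_one, specNorm]

lemma ham_bound {n : ℕ} (hn : 0 < n) (f g : Fin n → ℝ) (τ γ : ℝ) (hγ : γ = ⨅ i, |f i - τ|)
    (hγpos : 0 < γ) :
    (ham (thLabels f τ) (thLabels g τ) : ℝ) / n ≤
      ‖(WithLp.toLp 2 (fun i => f i - g i) : EuclideanSpace ℝ (Fin n))‖ / (Real.sqrt n * γ) := by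
  set N := ‖(WithLp.toLp 2 (fun i => f i - g i) : EuclideanSpace ℝ (Fin n))‖ with hN
  have hN2 : N ^ 2 = ∑ i, (f i - g i) ^ 2 := by
    rw [hN, EuclideanSpace.norm_sq_eq]; simp
  have hn' : (0 : ℝ) < n := by exact_mod_cast hn
  have h1 : ∀ i, γ ≤ |f i - τ| := fun i => by
    rw [hγ]; exact ciInf_le (Set.finite_range _).bddBelow i
  set s := Finset.univ.filter (fun i => thLabels f τ i ≠ thLabels g τ i) with hs
  have h2 : ∀ i ∈ s, γ ≤ |f i - g i| := by
    intro i hi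
    rw [hs, Finset.mem_filter] at hi
    have hi2 := hi.2
    have hg := h1 i
    simp only [thLabels] at hi2
    split_ifs at hi2 with a b b
    · exact absurd rfl hi2
    · rw [abs_of_pos (by linarith)] at hg
      exact le_trans (by linarith) (le_abs_self _)
    · rw [abs_of_nonpos (by linarith)] at hg
      exact le_trans (by linarith) (neg_le_abs _)
    · exact absurd rfl hi2
  have h3 : (s.card : ℝ) * γ ≤ ∑ i, |f i - g i| := by
    rw [← nsmul_eq_mul]
    refine (Finset.card_nsmul_le_sum s _ _ h2).trans ?_
    exact Finset.sum_le_sum_of_subset_of_nonneg (Finset.subset_univ _) fun _ _ _ => abs_nonneg _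
  have h4 : (∑ i, |f i - g i|) ^ 2 ≤ n * N ^ 2 := by
    have := sq_sum_le_card_mul_sum_sq (s := (Finset.univ : Finset (Fin n))) (f := fun i => |f i - g i|)
    simpa [hN2] using this
  have h5 : ∑ i, |f i - g i| ≤ Real.sqrt n * N := by
    refine le_sq_aux ?_ (by positivity)
    rw [mul_pow, Real.sq_sqrt hn'.le]; exact h4
  have hsq : Real.sqrt n * Real.sqrt n = n := Real.mul_self_sqrt hn'.le
  have hsp : 0 < Real.sqrt n := Real.sqrt_pos.2 hn'
  change (s.card : ℝ) / n ≤ _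
  rw [div_le_div_iff₀ hn' (by positivity)]
  calc (s.card : ℝ) * (Real.sqrt n * γ) = Real.sqrt n * (s.card * γ) := by ring
    _ ≤ Real.sqrt n * (Real.sqrt n * N) := mul_le_mul_of_nonneg_left (h3.trans h5) hsp.le
    _ = N * n := by rw [← mul_assoc, hsq]; ring

lemma gcn_diff {n : ℕ} (σ : ℝ → ℝ) (Cσ : ℝ) (hσ : ∀ a b, |σ a - σ b| ≤ Cσ * |a - b|)
    (h0 h1 : ℝ) (x : Fin n → ℝ) (M N : Matrix (Fin n) (Fin n) ℝ) :
    ‖(WithLp.toLp 2 (fun i => gcnOut σ h0 h1 x M i - gcnOut σ h0 h1 x N i) :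
        EuclideanSpace ℝ (Fin n))‖ ≤
      Cσ * |h1| * ‖(WithLp.toLp 2 (M.mulVec x - N.mulVec x) : EuclideanSpace ℝ (Fin n))‖ := by
  have hC : 0 ≤ Cσ := by
    have := (abs_nonneg _).trans (hσ 0 1)
    simpa using this
  refine le_sq_aux ?_ (by positivity)
  rw [mul_pow, EuclideanSpace.norm_sq_eq, EuclideanSpace.norm_sq_eq, Finset.mul_sum]
  refine Finset.sum_le_sum fun i _ => ?_
  rw [← mul_pow]
  refine pow_le_pow_left₀ (norm_nonneg _) ?_ 2
  simp only [Real.norm_eq_abs, gcnOut]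
  refine (hσ _ _).trans ?_
  rw [mul_assoc, ← abs_mul]
  apply le_of_eq
  congr 2
  simp [Matrix.add_mulVec, Matrix.smul_mulVec]
  ring

/-- **Theorem 1.** Misclassification rate of a one-layer GCN on a single
edge-subsampled graph: for every η ∈ (0,1), with probability at least 1 − η,
R(y(G), y(Ĝ)) ≤ (C_σ|h₁|/(√n γ_min)) {(1 − p_s)‖L‖₂ + √(4 p_s(1 − p_s)‖L‖₂ log(2n/η)) + (4/3) log(2n/η)}. -/
theorem gcn_subsample_misclassification_bound {n : ℕ} (hn : 0 < n)
    (A : Matrix (Fin n) (Fin n) ℝ)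
    (hA01 : ∀ i j, A i j = 0 ∨ A i j = 1) (hAsymm : A.IsSymm) (hAdiag : ∀ i, A i i = 0)
    {Ω : Type} [MeasurableSpace Ω] (μ : Measure Ω) [IsProbabilityMeasure μ]
    (ps : ℝ) (hps0 : 0 < ps) (hps1 : ps ≤ 1)
    (B : Fin n → Fin n → Ω → ℝ)
    (hBmeas : ∀ i j, Measurable (B i j))
    (hB01 : ∀ i j ω, B i j ω = 0 ∨ B i j ω = 1)
    (hBp : ∀ i j, μ {ω | B i j ω = 1} = ENNReal.ofReal ps)
    (hBindep : iIndepFun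
      (fun p : {p : Fin n × Fin n // p.1 < p.2} => B p.1.1 p.1.2) μ)
    (σ : ℝ → ℝ) (Cσ : ℝ) (hσ : ∀ a b, |σ a - σ b| ≤ Cσ * |a - b|)
    (h0 h1 : ℝ) (x : Fin n → ℝ) (hx : evNorm x = 1) (τ : ℝ)
    (γmin : ℝ) (hγ : γmin = ⨅ i, |gcnOut σ h0 h1 x (lap A) i - τ|) (hγpos : 0 < γmin)
    (η : ℝ) (hη0 : 0 < η) (hη1 : η < 1) :
    μ {ω | (ham (thLabels (gcnOut σ h0 h1 x (lap A)) τ)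
              (thLabels (gcnOut σ h0 h1 x (lapHat A B ω)) τ) : ℝ) / n
          ≤ fBound (lap A) Cσ h1 γmin ps η} ≥ ENNReal.ofReal (1 - η) := by
  have hn1 : (1 : ℝ) ≤ n := by exact_mod_cast hn
  have hC : 0 ≤ Cσ := by
    have := (abs_nonneg _).trans (hσ 0 1)
    simpa using this
  set l := Real.log (2 * n / η) with hl
  have harg : 1 < 2 * n / η := by
    rw [lt_div_iff₀ hη0]; linarith
  have hl0 : 0 < l := Real.log_pos harg
  have hq : 0 ≤ 1 - ps := by linarith
  have hxn := hx
  rw [evNorm_eq] at hxn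
  set w : {p : Fin n × Fin n // p.1 < p.2} → EuclideanSpace ℝ (Fin n) :=
    fun e => edgeVec A x e.1.1 e.1.2 with hw
  have hsum : ∀ {M : Type} [AddCommMonoid M] (F : Fin n × Fin n → M),
      ∑ q ∈ pairs n, F q = ∑ e : {p : Fin n × Fin n // p.1 < p.2}, F e.1 := by
    intro M _ F
    exact Finset.sum_subtype (pairs n) (fun q => by simp [pairs]) F
  have hwn : ∀ e, ‖w e‖ ^ 2 = 2 * (A e.1.1 e.1.2 * (x e.1.1 - x e.1.2) ^ 2) := fun e =>
    edgeVec_norm_sq A hA01 x _ _ e.2.ne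
  have hw2 : ∀ e, ‖w e‖ ≤ 2 := by
    intro e
    refine le_sq_aux ?_ (by norm_num)
    rw [hwn e]
    have hx1 : ∑ i, x i ^ 2 = 1 := by
      have := hx
      rw [evNorm, Real.sqrt_eq_one] at this
      exact this
    have hx2 : x e.1.1 ^ 2 + x e.1.2 ^ 2 ≤ 1 := by
      rw [← hx1, ← Finset.sum_pair (f := fun i => x i ^ 2) e.2.ne]
      exact Finset.sum_le_sum_of_subset_of_nonneg (Finset.subset_univ _) fun _ _ _ => sq_nonneg _
    rcases hA01 e.1.1 e.1.2 with h | h <;> rw [h] <;> nlinarith [sq_nonneg (x e.1.1 + x e.1.2)]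
  set V := 2 * ps * (1 - ps) * specNorm (lap A) with hV
  have hVb : ps * (1 - ps) * ∑ e, ‖w e‖ ^ 2 ≤ V := by
    simp_rw [hwn]
    rw [← Finset.mul_sum, ← hsum (fun q => A q.1 q.2 * (x q.1 - x q.2) ^ 2)]
    have := mul_le_mul_of_nonneg_left (quad_le A hAsymm hAdiag x hx) (mul_nonneg hps0.le hq)
    linarith
  have htail := vec_tail μ ps hps0.le hps1
    (fun p : {p : Fin n × Fin n // p.1 < p.2} => B p.1.1 p.1.2) (fun e => hBmeas _ _)
    (fun e => hB01 _ _) (fun e => hBp _ _) hBindep w hw2 Finset.univ V l hVb hl0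
  set t := Real.sqrt (2 * V * l) + 4 / 3 * l with ht
  set S : Ω → EuclideanSpace ℝ (Fin n) := fun ω =>
    ∑ e : {p : Fin n × Fin n // p.1 < p.2}, (B e.1.1 e.1.2 ω - ps) • w e with hS
  have hSm : Measurable S :=
    Finset.measurable_fun_sum _ fun e _ => ((hBmeas _ _).sub_const ps).smul_const _
  have hSeq : ∀ ω, S ω = WithLp.toLp 2 ((lapHat A B ω).mulVec x - ps • (lap A).mulVec x) := by
    intro ω
    have e1 : (lapHat A B ω).mulVec x - ps • (lap A).mulVec x =
        ∑ q ∈ pairs n, (B q.1 q.2 ω - ps) • (A q.1 q.2 • edgeMat q.1 q.2).mulVec x := by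
      rw [lapHat, lap_eq_sum A hAsymm hAdiag, Matrix.sum_mulVec, Matrix.sum_mulVec, Finset.smul_sum,
        ← Finset.sum_sub_distrib]
      refine Finset.sum_congr rfl fun q _ => ?_
      simp only [Matrix.smul_mulVec, smul_smul]
      rw [← sub_smul]
      congr 1; ring
    rw [e1, hsum (fun q => (B q.1 q.2 ω - ps) • (A q.1 q.2 • edgeMat q.1 q.2).mulVec x),
      WithLp.toLp_sum]
    rfl
  have hgood : {ω | t < ‖S ω‖}ᶜ ⊆ {ω | (ham (thLabels (gcnOut σ h0 h1 x (lap A)) τ)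
              (thLabels (gcnOut σ h0 h1 x (lapHat A B ω)) τ) : ℝ) / n
          ≤ fBound (lap A) Cσ h1 γmin ps η} := by
    intro ω hω
    have hω' : ‖S ω‖ ≤ t := not_lt.1 hω
    rw [Set.mem_ofPred_eq]
    refine (ham_bound hn _ _ τ γmin hγ hγpos).trans ?_
    rw [fBound, div_mul_eq_mul_div]
    apply div_le_div_of_nonneg_right _ (by positivity)
    refine (gcn_diff σ Cσ hσ h0 h1 x _ _).trans ?_
    apply mul_le_mul_of_nonneg_left _ (by positivity)
    have e2 : (WithLp.toLp 2 ((lap A).mulVec x - (lapHat A B ω).mulVec x) :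
        EuclideanSpace ℝ (Fin n)) =
        (1 - ps) • Matrix.toEuclideanCLM (𝕜 := ℝ) (lap A) (WithLp.toLp 2 x) - S ω := by
      rw [hSeq, Matrix.toEuclideanCLM_toLp, ← WithLp.toLp_smul, ← WithLp.toLp_sub]
      congr 1
      rw [sub_smul, one_smul]; abel
    rw [e2]
    refine (norm_sub_le _ _).trans ?_
    have e3 : ‖(1 - ps) • Matrix.toEuclideanCLM (𝕜 := ℝ) (lap A) (WithLp.toLp 2 x)‖ ≤
        (1 - ps) * specNorm (lap A) := by
      rw [norm_smul, Real.norm_eq_abs, abs_of_nonneg hq]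
      refine mul_le_mul_of_nonneg_left ?_ hq
      refine (ContinuousLinearMap.le_opNorm _ _).trans ?_
      rw [hxn, mul_one, specNorm]
    have e4 : t = Real.sqrt (4 * ps * (1 - ps) * specNorm (lap A) * l) + 4 / 3 * l := by
      rw [ht, hV]; congr 2; ring
    rw [add_assoc, ← e4]
    exact add_le_add e3 hω'
  have hms : MeasurableSet {ω | t < ‖S ω‖} := measurableSet_lt measurable_const hSm.norm
  refine le_trans ?_ (measure_mono hgood)
  rw [prob_compl_eq_one_sub hms, ENNReal.ofReal_sub _ hη0.le, ENNReal.ofReal_one]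
  refine tsub_le_tsub_left (htail.trans (ENNReal.ofReal_le_ofReal ?_)) 1
  rw [Real.exp_neg, hl, Real.exp_log (by linarith), inv_div, mul_div_assoc', div_le_iff₀ (by positivity)]
  nlinarith
end

section
/- Let G be a simple undirected graph on n vertices with Laplacian L, and Ĝ its edge-subsampled version (each edge retained independently with probability p_s ∈ (0,1]). Let labels y(G), y(Ĝ) ∈ {±1}ⁿ be obtained by thresholding the one-layer GCN output σ((h₀I + h₁L)x) at τ, with σ elementwise C_σ-Lipschitz, ‖x‖₂ = 1, and margin γ_min > 0. Then for every η ∈ (0,1), with probability at least 1 − η, Ham(y(G), y(Ĝ)) ≤ (√n C_σ |h₁| / γ_min) · { (1 − p_s)‖L‖₂ + √(4 p_s(1 − p_s)‖L‖₂ log(2n/η)) + (4/3) log(2n/η) }. -/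
open MeasureTheory ProbabilityTheory Finset
open scoped Classical

lemma aux_cosh_convex (t a b : ℝ) (r : ℝ) (ht0 : 0 ≤ t) (ht1 : t ≤ 1)
    (hr : r ^ 2 = t * a ^ 2 + (1 - t) * b ^ 2) :
    Real.cosh r ≤ t * Real.cosh a + (1 - t) * Real.cosh b := by
  have h1 := Real.hasSum_cosh r
  have h2 := ((Real.hasSum_cosh a).mul_left t).add ((Real.hasSum_cosh b).mul_left (1 - t))
  refine hasSum_le (fun k => ?_) h1 h2
  have hc := (convexOn_pow (𝕜 := ℝ) k).2 (x := a ^ 2) (sq_nonneg a) (y := b ^ 2) (sq_nonneg b)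
    ht0 (by linarith : 0 ≤ 1 - t) (by ring)
  simp only [smul_eq_mul] at hc
  rw [pow_mul, pow_mul, pow_mul, hr, ← mul_div_assoc, ← mul_div_assoc, ← add_div]
  gcongr

lemma aux_exp (y b : ℝ) (hy0 : 0 ≤ y) (hyb : y ≤ b) (hb : b < 3) :
    Real.exp y - 1 - y ≤ y ^ 2 / (2 * (1 - b / 3)) := by
  have h1 : HasSum (fun k : ℕ => y ^ k / (k.factorial : ℝ)) (Real.exp y) := by
    have := NormedSpace.expSeries_div_hasSum_exp (𝔸 := ℝ) y
    rwa [← Real.exp_eq_exp_ℝ] at this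
  have h2 := (hasSum_nat_add_iff' 2).2 h1
  have h3 : HasSum (fun k : ℕ => y ^ 2 / 2 * (b / 3) ^ k) (y ^ 2 / 2 * (1 - b / 3)⁻¹) :=
    (hasSum_geometric_of_lt_one (by linarith) (by linarith)).mul_left _
  have h4 := hasSum_le (fun k => ?_) h2 h3
  · simp [Finset.sum_range_succ] at h4
    have e : y ^ 2 / (2 * (1 - b / 3)) = y ^ 2 / 2 * (1 - b / 3)⁻¹ := by
      rw [← div_div, div_eq_mul_inv (y ^ 2 / 2)]
    rw [e]; linarith
  · have hf : (2 : ℝ) * 3 ^ k ≤ ((k + 2).factorial : ℝ) := by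
      have := Nat.factorial_mul_pow_le_factorial (m := 2) (n := k)
      rw [add_comm 2 k] at this
      exact_mod_cast this
    calc y ^ (k + 2) / ((k + 2).factorial : ℝ) ≤ y ^ (k + 2) / (2 * 3 ^ k) := by
          gcongr
      _ = y ^ 2 / 2 * (y / 3) ^ k := by rw [div_pow, pow_add]; field_simp
      _ ≤ _ := by gcongr

/-- Pinelis-type pointwise inequality. -/
lemma aux_pinelis {E : Type*} [NormedAddCommGroup E] [InnerProductSpace ℝ E] (s v : E) :
    Real.cosh ‖s + v‖ ≤ Real.cosh ‖s‖ + Real.sinh ‖s‖ / ‖s‖ * inner ℝ s v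
      + Real.cosh ‖s‖ * (Real.exp ‖v‖ - 1 - ‖v‖) := by
  rcases eq_or_ne s 0 with rfl | hs
  · simp
    have := Real.cosh_add_sinh ‖v‖
    have h2 := Real.self_le_sinh_iff.2 (norm_nonneg v)
    linarith
  rcases eq_or_ne v 0 with rfl | hv
  · simp
  have ha : 0 < ‖s‖ := norm_pos_iff.2 hs
  have hb : 0 < ‖v‖ := norm_pos_iff.2 hv
  have hn := norm_add_sq_real s v
  have hc := abs_real_inner_le_norm s v
  set a := ‖s‖
  set b := ‖v‖
  set c : ℝ := inner ℝ s v
  rw [abs_le] at hc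
  have hab : 0 < a * b := mul_pos ha hb
  obtain ⟨t, ht⟩ : ∃ t : ℝ, c = a * b * (2 * t - 1) := ⟨(c / (a * b) + 1) / 2, by field_simp; ring⟩
  have ht0 : 0 ≤ t := by
    by_contra h; push Not at h; nlinarith
  have ht1 : t ≤ 1 := by
    by_contra h; push Not at h; nlinarith
  have h := aux_cosh_convex t (a + b) (a - b) ‖s + v‖ ht0 ht1 (by rw [hn, ht]; ring)
  refine h.trans ?_
  have e1 : Real.sinh a / a * c = (2 * t - 1) * b * Real.sinh a := by
    rw [ht]; field_simp
  rw [e1, Real.cosh_add, Real.cosh_sub, ← Real.cosh_add_sinh b]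
  have hsb := Real.self_le_sinh_iff.2 hb.le
  have hsa := (Real.sinh_lt_cosh a).le
  have hsa0 : 0 ≤ Real.sinh a := Real.sinh_nonneg_iff.2 ha.le
  nlinarith [mul_nonneg (sub_nonneg.2 hsb) (sub_nonneg.2 hsa),
    mul_nonneg (mul_nonneg (sub_nonneg.2 hsb) hsa0) (sub_nonneg.2 ht1)]

lemma aux_pinelis' {E : Type*} [NormedAddCommGroup E] [InnerProductSpace ℝ E] (s w : E)
    (l R z : ℝ) (hl : 0 ≤ l) (hz : |z| ≤ 1) (hw : ‖w‖ ≤ R) (hlR : l * R < 3) :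
    Real.cosh (l * ‖s + z • w‖) ≤
      Real.cosh (l * ‖s‖) * (1 + l ^ 2 / (2 * (1 - l * R / 3)) * ‖w‖ ^ 2 * z ^ 2)
      + (Real.sinh (l * ‖s‖) / (l * ‖s‖) * (l ^ 2 * inner ℝ s w)) * z := by
  have h := aux_pinelis (l • s) (l • z • w)
  rw [← smul_add] at h
  simp only [norm_smul, Real.norm_eq_abs, abs_of_nonneg hl, inner_smul_left, inner_smul_right] at h
  have hb : l * (|z| * ‖w‖) ≤ l * R := by
    gcongr
    calc |z| * ‖w‖ ≤ 1 * ‖w‖ := by gcongr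
      _ ≤ R := by linarith
  have h2 := aux_exp (l * (|z| * ‖w‖)) (l * R) (by positivity) hb hlR
  have hcp := (Real.cosh_pos (l * ‖s‖)).le
  have h3 := mul_le_mul_of_nonneg_left h2 hcp
  refine h.trans ?_
  have e : (l * (|z| * ‖w‖)) ^ 2 = l ^ 2 * ‖w‖ ^ 2 * z ^ 2 := by
    rw [mul_pow, mul_pow, sq_abs]; ring
  rw [e] at h3
  have e2 : l ^ 2 * ‖w‖ ^ 2 * z ^ 2 / (2 * (1 - l * R / 3))
      = l ^ 2 / (2 * (1 - l * R / 3)) * ‖w‖ ^ 2 * z ^ 2 := by ring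
  rw [e2] at h3
  simp only [conj_trivial]
  nlinarith [h3]

lemma aux_mgf {E : Type*} [NormedAddCommGroup E] [InnerProductSpace ℝ E] [FiniteDimensional ℝ E]
    [MeasurableSpace E] [BorelSpace E]
    {Ω : Type*} [MeasurableSpace Ω] (μ : Measure Ω) [IsProbabilityMeasure μ]
    {ι : Type*} (ξ : ι → Ω → ℝ) (hm : ∀ i, Measurable (ξ i)) (hi : iIndepFun ξ μ)
    (hb : ∀ i ω, |ξ i ω| ≤ 1) (h0 : ∀ i, ∫ ω, ξ i ω ∂μ = 0) (q : ℝ)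
    (hq : ∀ i, ∫ ω, (ξ i ω) ^ 2 ∂μ = q) (w : ι → E) (l R : ℝ) (hl : 0 ≤ l)
    (hw : ∀ i, ‖w i‖ ≤ R) (hlR : l * R < 3) (s : Finset ι) :
    ∫ ω, Real.cosh (l * ‖∑ i ∈ s, ξ i ω • w i‖) ∂μ ≤
      Real.exp (l ^ 2 / (2 * (1 - l * R / 3)) * (q * ∑ i ∈ s, ‖w i‖ ^ 2)) := by
  have hSm : ∀ s : Finset ι, Measurable (fun ω => ∑ i ∈ s, ξ i ω • w i) := by
    intro s; exact Finset.measurable_sum s (fun i _ => (hm i).smul_const _)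
  have hSb : ∀ s : Finset ι, ∀ ω, ‖∑ i ∈ s, ξ i ω • w i‖ ≤ ∑ i ∈ s, ‖w i‖ := by
    intro s ω
    refine (norm_sum_le _ _).trans (Finset.sum_le_sum fun i _ => ?_)
    rw [norm_smul]
    have := mul_le_mul_of_nonneg_right (hb i ω) (norm_nonneg (w i))
    simpa using this
  have hci : ∀ s : Finset ι, Integrable (fun ω => Real.cosh (l * ‖∑ i ∈ s, ξ i ω • w i‖)) μ := by
    intro s
    refine Integrable.of_bound (C := Real.cosh (l * ∑ i ∈ s, ‖w i‖)) ?_ (ae_of_all _ fun ω => ?_)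
    · exact (Real.measurable_cosh.comp ((hSm s).norm.const_mul l)).aestronglyMeasurable
    · rw [Real.norm_eq_abs, abs_of_pos (Real.cosh_pos _), Real.cosh_le_cosh,
        abs_of_nonneg (by positivity), abs_of_nonneg (mul_nonneg hl (Finset.sum_nonneg fun _ _ => norm_nonneg _))]
      exact mul_le_mul_of_nonneg_left (hSb s ω) hl
  induction s using Finset.induction_on with
  | empty => simp
  | insert j s hj ih =>
    set K := l ^ 2 / (2 * (1 - l * R / 3)) with hK
    have hK0 : 0 ≤ K := by
      have : 0 < 1 - l * R / 3 := by linarith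
      positivity
    have hq0 : 0 ≤ q := by rw [← hq j]; exact integral_nonneg fun _ => sq_nonneg _
    -- independence
    have hind : IndepFun (fun ω => ∑ i ∈ s, ξ i ω • w i) (ξ j) μ := by
      have h1 := hi.indepFun_finset s {j} (by simpa using hj) hm
      have hmj : Measurable (fun f : ({j} : Finset ι) → ℝ => f ⟨j, by simp⟩) :=
        measurable_pi_apply _
      have h2 := h1.comp (φ := fun f : s → ℝ => ∑ i : s, f i • w i)
        (ψ := fun f : ({j} : Finset ι) → ℝ => f ⟨j, by simp⟩)
        (Finset.measurable_sum _ (fun i _ => (measurable_pi_apply i).smul_const _))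
        hmj
      have e1 : (fun ω => ∑ i ∈ s, ξ i ω • w i) = (fun f : s → ℝ => ∑ i : s, f i • w i) ∘
          fun a (i : s) => ξ i a := by
        funext ω
        simp only [Function.comp]
        rw [← Finset.sum_coe_sort]
      rw [e1]
      exact h2
    let F : E → ℝ := fun u => Real.cosh (l * ‖u‖)
    let D : E → ℝ := fun u => Real.sinh (l * ‖u‖) / (l * ‖u‖) * (l ^ 2 * inner ℝ u (w j))
    have hFm : Measurable F := Real.measurable_cosh.comp (measurable_norm.const_mul l)
    have hDm : Measurable D := by
      refine Measurable.mul (Measurable.div (Real.measurable_sinh.comp (measurable_norm.const_mul l))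
        (measurable_norm.const_mul l)) (Measurable.const_mul ?_ _)
      exact Continuous.measurable (by fun_prop)
    let G : ℝ → ℝ := fun z => 1 + K * ‖w j‖ ^ 2 * z ^ 2
    have hGm : Measurable G := by fun_prop
    have hindF := hind.comp hFm hGm
    have hindD := hind.comp (φ := D) (ψ := id) hDm measurable_id
    have hDi : Integrable (fun ω => D (∑ i ∈ s, ξ i ω • w i)) μ := by
      refine Integrable.of_bound (C := Real.sinh (l * ∑ i ∈ s, ‖w i‖) * (l * ‖w j‖)) ?_
        (ae_of_all _ fun ω => ?_)
      · exact (hDm.comp (hSm s)).aestronglyMeasurable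
      · set u := ∑ i ∈ s, ξ i ω • w i with hu
        have hub : ‖u‖ ≤ _ := hSb s ω
        have hs0 : 0 ≤ Real.sinh (l * ‖u‖) := Real.sinh_nonneg_iff.2 (by positivity)
        have hs1 : Real.sinh (l * ‖u‖) ≤ Real.sinh (l * ∑ i ∈ s, ‖w i‖) :=
          Real.sinh_le_sinh.2 (mul_le_mul_of_nonneg_left hub hl)
        refine le_trans ?_ (mul_le_mul_of_nonneg_right hs1 (by positivity))
        simp only [D, Real.norm_eq_abs, abs_mul, abs_div, abs_of_nonneg hs0, abs_of_nonneg hl,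
          abs_norm, abs_of_nonneg (sq_nonneg l)]
        rcases eq_or_ne (l * ‖u‖) 0 with h | h
        · rw [h]; simp
        · have hip := abs_real_inner_le_norm u (w j)
          calc _ ≤ Real.sinh (l * ‖u‖) / (l * ‖u‖) * (l ^ 2 * (‖u‖ * ‖w j‖)) := by
                gcongr
            _ = Real.sinh (l * ‖u‖) * (l * ‖w j‖) * ((l * ‖u‖) / (l * ‖u‖)) := by ring
            _ = _ := by rw [div_self h, mul_one]
    have hξi : Integrable (ξ j) μ := Integrable.of_bound (C := 1) (hm j).aestronglyMeasurable
      (ae_of_all _ fun ω => hb j ω)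
    have hξ2i : Integrable (fun ω => ξ j ω ^ 2) μ :=
      Integrable.of_bound (C := 1) ((hm j).pow_const 2).aestronglyMeasurable
      (ae_of_all _ fun ω => by
        rw [Real.norm_eq_abs, abs_pow]; exact pow_le_one₀ (abs_nonneg _) (hb j ω))
    have hGi : Integrable (fun ω => G (ξ j ω)) μ := (integrable_const 1).add (hξ2i.const_mul _)
    have hFG : Integrable (fun ω => F (∑ i ∈ s, ξ i ω • w i) * G (ξ j ω)) μ :=
      hindF.integrable_mul (hci s) hGi
    have hDX : Integrable (fun ω => D (∑ i ∈ s, ξ i ω • w i) * ξ j ω) μ :=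
      hindD.integrable_mul hDi hξi
    have e1 : ∫ ω, F (∑ i ∈ s, ξ i ω • w i) * G (ξ j ω) ∂μ
        = (∫ ω, F (∑ i ∈ s, ξ i ω • w i) ∂μ) * ∫ ω, G (ξ j ω) ∂μ :=
      hindF.integral_fun_mul_eq_mul_integral (hci s).aestronglyMeasurable hGi.aestronglyMeasurable
    have e2 : ∫ ω, D (∑ i ∈ s, ξ i ω • w i) * ξ j ω ∂μ
        = (∫ ω, D (∑ i ∈ s, ξ i ω • w i) ∂μ) * ∫ ω, ξ j ω ∂μ :=
      hindD.integral_fun_mul_eq_mul_integral hDi.aestronglyMeasurable hξi.aestronglyMeasurable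
    have e3 : ∫ ω, G (ξ j ω) ∂μ = 1 + K * ‖w j‖ ^ 2 * q := by
      simp only [G]
      rw [integral_add (integrable_const 1) (hξ2i.const_mul _), integral_const_mul, hq]
      simp
    calc ∫ ω, Real.cosh (l * ‖∑ i ∈ insert j s, ξ i ω • w i‖) ∂μ
        ≤ ∫ ω, (F (∑ i ∈ s, ξ i ω • w i) * G (ξ j ω) + D (∑ i ∈ s, ξ i ω • w i) * ξ j ω) ∂μ := by
          refine integral_mono (hci _) (hFG.add hDX) fun ω => ?_
          simp only
          rw [Finset.sum_insert hj, add_comm (ξ j ω • w j)]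
          exact aux_pinelis' _ _ l R _ hl (hb j ω) (hw j) hlR
      _ = (∫ ω, F (∑ i ∈ s, ξ i ω • w i) ∂μ) * (1 + K * ‖w j‖ ^ 2 * q) := by
          rw [integral_add hFG hDX, e1, e2, h0, e3]; simp
      _ ≤ Real.exp (K * (q * ∑ i ∈ s, ‖w i‖ ^ 2)) * Real.exp (K * ‖w j‖ ^ 2 * q) := by
          refine mul_le_mul ih ?_ (by positivity) (Real.exp_nonneg _)
          rw [add_comm]; exact Real.add_one_le_exp _
      _ = _ := by
          rw [← Real.exp_add, Finset.sum_insert hj]; congr 1; ring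

/-- Bernstein inequality for vectors, with bound 2 on the increments. -/
lemma aux_bernstein {E : Type*} [NormedAddCommGroup E] [InnerProductSpace ℝ E]
    [FiniteDimensional ℝ E] [MeasurableSpace E] [BorelSpace E]
    {Ω : Type*} [MeasurableSpace Ω] (μ : Measure Ω) [IsProbabilityMeasure μ]
    {ι : Type*} [Fintype ι] (ξ : ι → Ω → ℝ) (hm : ∀ i, Measurable (ξ i)) (hi : iIndepFun ξ μ)
    (hb : ∀ i ω, |ξ i ω| ≤ 1) (h0 : ∀ i, ∫ ω, ξ i ω ∂μ = 0) (q : ℝ)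
    (hq : ∀ i, ∫ ω, (ξ i ω) ^ 2 ∂μ = q) (w : ι → E)
    (hw : ∀ i, ‖w i‖ ≤ 2) (v L : ℝ) (hv0 : 0 ≤ v) (hv : q * ∑ i, ‖w i‖ ^ 2 ≤ v) (hL : 0 < L) :
    μ.real {ω | Real.sqrt (2 * v * L) + 4 / 3 * L ≤ ‖∑ i, ξ i ω • w i‖} ≤ 2 * Real.exp (-L) := by
  set t := Real.sqrt (2 * v * L) + 4 / 3 * L with ht
  have ht0 : 0 < t := by positivity
  have hSm : Measurable (fun ω => ∑ i, ξ i ω • w i) :=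
    Finset.measurable_sum _ (fun i _ => (hm i).smul_const _)
  have key : ∀ l : ℝ, 0 ≤ l → l * 2 < 3 →
      l ^ 2 / (2 * (1 - l * 2 / 3)) * v - l * t ≤ -L →
      μ.real {ω | t ≤ ‖∑ i, ξ i ω • w i‖} ≤ 2 * Real.exp (-L) := by
    intro l hl hl2 hle
    have hmgf := aux_mgf μ ξ hm hi hb h0 q hq w l 2 hl hw hl2 Finset.univ
    have hK0 : 0 ≤ l ^ 2 / (2 * (1 - l * 2 / 3)) := by
      have : 0 < 1 - l * 2 / 3 := by linarith
      positivity
    have hint : Integrable (fun ω => Real.cosh (l * ‖∑ i, ξ i ω • w i‖)) μ := by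
      refine Integrable.of_bound (C := Real.cosh (l * ∑ i, ‖w i‖)) ?_ (ae_of_all _ fun ω => ?_)
      · exact (Real.measurable_cosh.comp (hSm.norm.const_mul l)).aestronglyMeasurable
      · rw [Real.norm_eq_abs, abs_of_pos (Real.cosh_pos _), Real.cosh_le_cosh,
          abs_of_nonneg (by positivity),
          abs_of_nonneg (mul_nonneg hl (Finset.sum_nonneg fun _ _ => norm_nonneg _))]
        refine mul_le_mul_of_nonneg_left ?_ hl
        refine (norm_sum_le _ _).trans (Finset.sum_le_sum fun i _ => ?_)
        rw [norm_smul]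
        have := mul_le_mul_of_nonneg_right (hb i ω) (norm_nonneg (w i))
        simpa using this
    have hmk := mul_meas_ge_le_integral_of_nonneg
      (ae_of_all μ fun ω => (Real.cosh_pos (l * ‖∑ i, ξ i ω • w i‖)).le) hint (Real.cosh (l * t))
    have hsub : μ.real {ω | t ≤ ‖∑ i, ξ i ω • w i‖} ≤
        μ.real {ω | Real.cosh (l * t) ≤ Real.cosh (l * ‖∑ i, ξ i ω • w i‖)} := by
      refine measureReal_mono (fun ω hω => ?_)
      simp only [Set.mem_ofPred_eq] at hω ⊢
      rw [Real.cosh_le_cosh, abs_of_nonneg (by positivity), abs_of_nonneg (by positivity)]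
      exact mul_le_mul_of_nonneg_left hω hl
    have hcosh : Real.exp (l * t) / 2 ≤ Real.cosh (l * t) := by
      rw [Real.cosh_eq]; have := Real.exp_pos (-(l * t)); linarith
    have h1 : Real.exp (l * t) / 2 * μ.real {ω | t ≤ ‖∑ i, ξ i ω • w i‖} ≤
        Real.exp (l ^ 2 / (2 * (1 - l * 2 / 3)) * v) := by
      refine le_trans (mul_le_mul hcosh hsub measureReal_nonneg (Real.cosh_pos _).le) ?_
      refine hmk.trans (hmgf.trans (Real.exp_le_exp.2 ?_))
      exact mul_le_mul_of_nonneg_left hv hK0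
    have h2 : Real.exp (l ^ 2 / (2 * (1 - l * 2 / 3)) * v) ≤ Real.exp (l * t) * Real.exp (-L) := by
      rw [← Real.exp_add]; exact Real.exp_le_exp.2 (by linarith)
    have h3 := Real.exp_pos (l * t)
    refine le_of_mul_le_mul_left (a := Real.exp (l * t) / 2) ?_ (by positivity)
    linarith
  rcases hv0.eq_or_lt with h | h
  · refine key (3 / 4) (by norm_num) (by norm_num) ?_
    rw [ht, ← h]; simp; linarith
  · have hd : 0 < v + 2 / 3 * t := by positivity
    refine key (t / (v + 2 / 3 * t)) (by positivity) ?_ ?_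
    · rw [div_mul_eq_mul_div, div_lt_iff₀ hd]; linarith
    · have e : 1 - t / (v + 2 / 3 * t) * 2 / 3 = v / (v + 2 / 3 * t) := by
        field_simp; ring
      rw [e]
      have e2 : (t / (v + 2 / 3 * t)) ^ 2 / (2 * (v / (v + 2 / 3 * t))) * v
          - t / (v + 2 / 3 * t) * t = - (t ^ 2 / (2 * (v + 2 / 3 * t))) := by
        field_simp; ring
      rw [e2, neg_le_neg_iff, le_div_iff₀ (by positivity)]
      have hs : Real.sqrt (2 * v * L) ^ 2 = 2 * v * L := Real.sq_sqrt (by positivity)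
      have hs0 := Real.sqrt_nonneg (2 * v * L)
      rw [ht]
      nlinarith [mul_nonneg hs0 hL.le]

noncomputable def auxD {n : ℕ} (i j : Fin n) : Fin n → ℝ :=
  fun k => (if k = i then (1 : ℝ) else 0) - (if k = j then 1 else 0)

lemma aux_sum_pairs {n : ℕ} (f : Fin n → Fin n → ℝ) (hs : ∀ i j, f i j = f j i)
    (hd : ∀ i, f i i = 0) : 2 * ∑ p ∈ pairs n, f p.1 p.2 = ∑ i, ∑ j, f i j := by
  have h1 : ∑ p ∈ pairs n, f p.1 p.2 = ∑ i, ∑ j, if i < j then f i j else 0 := by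
    rw [pairs, Finset.sum_filter, Fintype.sum_prod_type]
  have h2 : ∑ i, ∑ j, (if j < i then f i j else 0) = ∑ i, ∑ j, if i < j then f i j else 0 := by
    rw [Finset.sum_comm]
    refine Finset.sum_congr rfl fun i _ => Finset.sum_congr rfl fun j _ => ?_
    rw [hs j i]
  rw [two_mul, h1]
  nth_rewrite 2 [← h2]
  rw [← Finset.sum_add_distrib]
  refine Finset.sum_congr rfl fun i _ => ?_
  rw [← Finset.sum_add_distrib]
  refine Finset.sum_congr rfl fun j _ => ?_
  rcases lt_trichotomy i j with h | h | h
  · simp [h, h.not_gt]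
  · subst h; simp [hd]
  · simp [h, h.not_gt]

lemma aux_edge_mulVec {n : ℕ} (i j : Fin n) (x : Fin n → ℝ) :
    (edgeMat i j).mulVec x = (x i - x j) • auxD i j := by
  funext k
  simp only [edgeMat, Matrix.mulVec, dotProduct, Matrix.vecMulVec_apply, Pi.smul_apply, smul_eq_mul,
    auxD]
  simp only [mul_assoc]
  rw [← Finset.mul_sum]
  simp only [sub_mul, Finset.sum_sub_distrib, ite_mul, one_mul, zero_mul, Finset.sum_ite_eq',
    Finset.mem_univ, if_true]
  split_ifs <;> ring

lemma aux_lap_mulVec {n : ℕ} (A : Matrix (Fin n) (Fin n) ℝ) (hAsymm : A.IsSymm)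
    (x : Fin n → ℝ) :
    (lap A).mulVec x = ∑ p ∈ pairs n, (A p.1 p.2 * (x p.1 - x p.2)) • auxD p.1 p.2 := by
  funext k
  have hs : ∀ i j, A i j = A j i := fun i j => (hAsymm.apply i j).symm
  have h := aux_sum_pairs (fun i j => A i j * (x i - x j) * auxD i j k)
    (fun i j => by simp only [auxD]; rw [hs i j]; ring) (fun i => by simp)
  rw [Finset.sum_apply]
  simp only [Pi.smul_apply, smul_eq_mul]
  have e : ∑ i, ∑ j, A i j * (x i - x j) * auxD i j k = 2 * ∑ j, A k j * (x k - x j) := by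
    have hh : ∀ i j, A i j * (x i - x j) * auxD i j k =
        (if k = i then A i j * (x i - x j) else 0) - (if k = j then A i j * (x i - x j) else 0) := by
      intro i j; simp only [auxD]; split_ifs <;> ring
    simp only [hh, Finset.sum_sub_distrib]
    rw [Finset.sum_comm (f := fun i j => if k = i then A i j * (x i - x j) else 0)]
    simp only [Finset.sum_ite_eq, Finset.mem_univ, if_true]
    rw [two_mul, sub_eq_add_neg, ← Finset.sum_neg_distrib]
    congr 1
    refine Finset.sum_congr rfl fun i _ => ?_
    rw [hs i k]; ring
  have h3 : (lap A).mulVec x k = ∑ j, A k j * (x k - x j) := by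
    simp only [lap, Matrix.sub_mulVec, Pi.sub_apply, Matrix.mulVec_diagonal]
    simp only [Matrix.mulVec, dotProduct, mul_sub, Finset.sum_sub_distrib, Finset.sum_mul]
  rw [h3]; linarith

lemma aux_evNorm {n : ℕ} (u : Fin n → ℝ) : evNorm u = ‖WithLp.toLp 2 u‖ := by
  rw [evNorm, EuclideanSpace.norm_eq]; simp

lemma aux_specNorm {n : ℕ} (M : Matrix (Fin n) (Fin n) ℝ) (x : Fin n → ℝ) (hx : evNorm x = 1) :
    ‖WithLp.toLp 2 (M.mulVec x)‖ ≤ specNorm M := by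
  have h := (Matrix.toEuclideanCLM (𝕜 := ℝ) M).le_opNorm (WithLp.toLp 2 x)
  rw [← aux_evNorm x, hx, mul_one] at h
  exact h

lemma aux_normD {n : ℕ} (i j : Fin n) (h : i ≠ j) :
    ‖WithLp.toLp 2 (auxD i j)‖ ^ 2 = 2 := by
  rw [EuclideanSpace.norm_sq_eq]
  have : ∀ k, ‖auxD i j k‖ ^ 2 = (if k = i then (1 : ℝ) else 0) + (if k = j then 1 else 0) := by
    intro k
    simp only [auxD]
    by_cases h1 : k = i
    · subst h1; simp [h]
    · by_cases h2 : k = j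
      · subst h2; simp [h1]
      · simp [h1, h2]
  simp only [this, Finset.sum_add_distrib, Finset.sum_ite_eq', Finset.mem_univ, if_true]
  norm_num

/-- Quadratic form of the Laplacian is at most its spectral norm. -/
lemma aux_quad {n : ℕ} (A : Matrix (Fin n) (Fin n) ℝ) (hAsymm : A.IsSymm)
    (x : Fin n → ℝ) (hx : evNorm x = 1) :
    ∑ p ∈ pairs n, A p.1 p.2 * (x p.1 - x p.2) ^ 2 ≤ specNorm (lap A) := by
  have h1 := aux_specNorm (lap A) x hx
  have h2 := real_inner_le_norm (WithLp.toLp 2 x) (WithLp.toLp 2 ((lap A).mulVec x))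
  rw [← aux_evNorm x, hx, one_mul] at h2
  refine le_trans (le_of_eq ?_) (h2.trans h1)
  have hd : ∀ i j : Fin n, ∑ k, x k * auxD i j k = x i - x j := by
    intro i j
    simp [auxD, mul_sub, Finset.sum_sub_distrib]
  rw [EuclideanSpace.inner_toLp_toLp, aux_lap_mulVec A hAsymm]
  simp only [dotProduct, Finset.sum_apply, Pi.smul_apply, smul_eq_mul, Pi.star_apply, star_trivial,
    Finset.sum_mul]
  rw [Finset.sum_comm]
  refine Finset.sum_congr rfl fun p _ => ?_
  have : ∀ k, A p.1 p.2 * (x p.1 - x p.2) * auxD p.1 p.2 k * x k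
      = A p.1 p.2 * (x p.1 - x p.2) * (x k * auxD p.1 p.2 k) := fun k => by ring
  simp only [this]
  rw [← Finset.mul_sum, hd]; ring

lemma aux_diff_sq {n : ℕ} (x : Fin n → ℝ) (hx : evNorm x = 1) (i j : Fin n) (h : i ≠ j) :
    (x i - x j) ^ 2 ≤ 2 := by
  have h1 : ∑ k, x k ^ 2 = 1 := by
    rw [evNorm, Real.sqrt_eq_one] at hx; exact hx
  have h2 : ∑ k ∈ ({i, j} : Finset (Fin n)), x k ^ 2 ≤ ∑ k, x k ^ 2 :=
    Finset.sum_le_sum_of_subset_of_nonneg (Finset.subset_univ _) fun _ _ _ => sq_nonneg _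
  rw [Finset.sum_pair h, h1] at h2
  nlinarith [sq_nonneg (x i + x j)]

/-- Deterministic part. -/
lemma aux_det {n : ℕ} (M N : Matrix (Fin n) (Fin n) ℝ)
    (σ : ℝ → ℝ) (Cσ : ℝ) (hσ : ∀ a b, |σ a - σ b| ≤ Cσ * |a - b|)
    (h0 h1 : ℝ) (x : Fin n → ℝ) (τ : ℝ)
    (γmin : ℝ) (hγ : γmin = ⨅ i, |gcnOut σ h0 h1 x M i - τ|) (hγpos : 0 < γmin) :
    (ham (thLabels (gcnOut σ h0 h1 x M) τ) (thLabels (gcnOut σ h0 h1 x N) τ) : ℝ)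
      ≤ Real.sqrt n * Cσ * |h1| / γmin *
        ‖WithLp.toLp 2 (N.mulVec x) - WithLp.toLp 2 (M.mulVec x)‖ := by
  have hC : 0 ≤ Cσ := by
    have := (abs_nonneg _).trans (hσ 1 0); simpa using this
  have hγi : ∀ i, γmin ≤ |gcnOut σ h0 h1 x M i - τ| := by
    intro i; rw [hγ]; exact ciInf_le (Set.finite_range _).bddBelow i
  set u : Fin n → ℝ := N.mulVec x - M.mulVec x with hu
  have hdiff : ∀ i, |gcnOut σ h0 h1 x M i - gcnOut σ h0 h1 x N i| ≤ Cσ * |h1| * |u i| := by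
    intro i
    refine (hσ _ _).trans (le_of_eq ?_)
    rw [mul_assoc, ← abs_mul, ← abs_neg]
    congr 2
    simp only [Matrix.add_mulVec, Matrix.smul_mulVec, Pi.add_apply, Pi.smul_apply, smul_eq_mul, hu,
      Pi.sub_apply]
    ring
  have hcard : γmin * (ham (thLabels (gcnOut σ h0 h1 x M) τ) (thLabels (gcnOut σ h0 h1 x N) τ) : ℝ)
      ≤ ∑ i, Cσ * |h1| * |u i| := by
    rw [ham, mul_comm, ← nsmul_eq_mul, ← Finset.sum_const]
    refine le_trans (Finset.sum_le_sum fun i hi => ?_)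
      (Finset.sum_le_sum_of_subset_of_nonneg (Finset.filter_subset _ _) fun _ _ _ => by positivity)
    refine le_trans ?_ (hdiff i)
    have hne := (Finset.mem_filter.1 hi).2
    have hg := hγi i
    simp only [thLabels] at hne
    by_cases ha : τ < gcnOut σ h0 h1 x M i <;> by_cases hb : τ < gcnOut σ h0 h1 x N i
    · simp [ha, hb] at hne
    · rw [abs_of_pos (by linarith)] at hg
      exact le_trans (by linarith) (le_abs_self _)
    · rw [abs_of_nonpos (by linarith)] at hg
      exact le_trans (by linarith) (neg_le_abs _)
    · simp [ha, hb] at hne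
  have hcs : ∑ i, |u i| ≤ Real.sqrt n * evNorm u := by
    rw [evNorm, ← Real.sqrt_mul (by positivity)]
    refine Real.le_sqrt_of_sq_le ?_
    have := sq_sum_le_card_mul_sum_sq (s := Finset.univ) (f := fun i => |u i|)
    simpa using this
  have he : ‖WithLp.toLp 2 (N.mulVec x) - WithLp.toLp 2 (M.mulVec x)‖ = evNorm u := by
    rw [aux_evNorm, hu, WithLp.toLp_sub]
  rw [he, div_mul_eq_mul_div, le_div_iff₀ hγpos, mul_comm _ γmin]
  refine hcard.trans ?_
  rw [← Finset.mul_sum]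
  have := mul_le_mul_of_nonneg_left hcs (by positivity : 0 ≤ Cσ * |h1|)
  linarith

/-- High-probability Hamming bound for the GCN labeling of the subsampled
graph: with probability at least 1 − η,
Ham(y(G), y(Ĝ)) ≤ (√n C_σ |h₁| / γ_min) {(1 − p_s)‖L‖₂ + √(4 p_s(1 − p_s)‖L‖₂ log(2n/η)) + (4/3) log(2n/η)}. -/
theorem gcn_subsample_hamming_bound {n : ℕ} (hn : 0 < n)
    (A : Matrix (Fin n) (Fin n) ℝ)
    (hA01 : ∀ i j, A i j = 0 ∨ A i j = 1) (hAsymm : A.IsSymm) (hAdiag : ∀ i, A i i = 0)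
    {Ω : Type} [MeasurableSpace Ω] (μ : Measure Ω) [IsProbabilityMeasure μ]
    (ps : ℝ) (hps0 : 0 < ps) (hps1 : ps ≤ 1)
    (B : Fin n → Fin n → Ω → ℝ)
    (hBmeas : ∀ i j, Measurable (B i j))
    (hB01 : ∀ i j ω, B i j ω = 0 ∨ B i j ω = 1)
    (hBp : ∀ i j, μ {ω | B i j ω = 1} = ENNReal.ofReal ps)
    (hBindep : iIndepFun
      (fun p : {p : Fin n × Fin n // p.1 < p.2} => B p.1.1 p.1.2) μ)
    (σ : ℝ → ℝ) (Cσ : ℝ) (hσ : ∀ a b, |σ a - σ b| ≤ Cσ * |a - b|)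
    (h0 h1 : ℝ) (x : Fin n → ℝ) (hx : evNorm x = 1) (τ : ℝ)
    (γmin : ℝ) (hγ : γmin = ⨅ i, |gcnOut σ h0 h1 x (lap A) i - τ|) (hγpos : 0 < γmin)
    (η : ℝ) (hη0 : 0 < η) (hη1 : η < 1) :
    μ {ω | (ham (thLabels (gcnOut σ h0 h1 x (lap A)) τ)
              (thLabels (gcnOut σ h0 h1 x (lapHat A B ω)) τ) : ℝ)
          ≤ Real.sqrt n * Cσ * |h1| / γmin *
              ((1 - ps) * specNorm (lap A)
                + Real.sqrt (4 * ps * (1 - ps) * specNorm (lap A) * Real.log (2 * n / η))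
                + 4 / 3 * Real.log (2 * n / η))} ≥ ENNReal.ofReal (1 - η) := by

  have hC : 0 ≤ Cσ := by
    have := (abs_nonneg _).trans (hσ 1 0); simpa using this
  have hn1 : (1 : ℝ) ≤ n := by exact_mod_cast hn
  set ℓ := Real.log (2 * n / η) with hℓ
  have hℓ0 : 0 < ℓ := by
    refine Real.log_pos ?_
    rw [one_lt_div hη0]; linarith
  have hS0 : 0 ≤ specNorm (lap A) := norm_nonneg _
  let ι := {p : Fin n × Fin n // p.1 < p.2}
  let ξ : ι → Ω → ℝ := fun p ω => B p.1.1 p.1.2 ω - ps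
  let w : ι → EuclideanSpace ℝ (Fin n) := fun p =>
    (A p.1.1 p.1.2 * (x p.1.1 - x p.1.2)) • WithLp.toLp 2 (auxD p.1.1 p.1.2)
  have hpairs : ∀ p, p ∈ pairs n ↔ p.1 < p.2 := by intro p; simp [pairs]
  have hA2 : ∀ i j, A i j ^ 2 = A i j := by
    intro i j; rcases hA01 i j with h | h <;> simp [h]
  have hA1 : ∀ i j, A i j ≤ 1 := by
    intro i j; rcases hA01 i j with h | h <;> simp [h]
  have hw2 : ∀ p : ι, ‖w p‖ ^ 2 = 2 * (A p.1.1 p.1.2 * (x p.1.1 - x p.1.2) ^ 2) := by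
    intro p
    simp only [w]
    rw [norm_smul, mul_pow, aux_normD _ _ p.2.ne, Real.norm_eq_abs, sq_abs, mul_pow, hA2]; ring
  have hw : ∀ p, ‖w p‖ ≤ 2 := by
    intro p
    have h2 := hw2 p
    have h3 := aux_diff_sq x hx p.1.1 p.1.2 p.2.ne
    have h4 := mul_le_mul_of_nonneg_right (hA1 p.1.1 p.1.2) (sq_nonneg (x p.1.1 - x p.1.2))
    exact le_of_sq_le_sq (by nlinarith) (by norm_num)
  have hm : ∀ p, Measurable (ξ p) := fun p => (hBmeas _ _).sub_const _
  have hi : iIndepFun ξ μ := hBindep.comp (fun _ z => z - ps) (fun _ => measurable_id.sub_const ps)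
  have hb : ∀ p ω, |ξ p ω| ≤ 1 := by
    intro p ω
    simp only [ξ]
    rw [abs_le]
    rcases hB01 p.1.1 p.1.2 ω with h | h <;> rw [h] <;> constructor <;> linarith
  have hBint : ∀ i j, Integrable (B i j) μ := fun i j =>
    Integrable.of_bound (C := 1) (hBmeas i j).aestronglyMeasurable
      (ae_of_all _ fun ω => by rcases hB01 i j ω with h | h <;> simp [h])
  have hBE : ∀ i j, ∫ ω, B i j ω ∂μ = ps := by
    intro i j
    have e : B i j = Set.indicator {ω | B i j ω = 1} 1 := by
      funext ω
      rcases hB01 i j ω with h | h <;> simp [Set.indicator, h]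
    have hms : MeasurableSet {ω | B i j ω = 1} := (hBmeas i j) (measurableSet_singleton 1)
    rw [e, integral_indicator_one hms, Measure.real, hBp,
      ENNReal.toReal_ofReal hps0.le]
  have h0' : ∀ p, ∫ ω, ξ p ω ∂μ = 0 := by
    intro p
    simp only [ξ]
    rw [integral_sub (hBint _ _) (integrable_const _), hBE]; simp
  have hq : ∀ p, ∫ ω, (ξ p ω) ^ 2 ∂μ = ps * (1 - ps) := by
    intro p
    have e : ∀ ω, (ξ p ω) ^ 2 = (1 - 2 * ps) * B p.1.1 p.1.2 ω + ps ^ 2 := by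
      intro ω
      simp only [ξ]
      rcases hB01 p.1.1 p.1.2 ω with h | h <;> rw [h] <;> ring
    simp only [e]
    rw [integral_add ((hBint _ _).const_mul _) (integrable_const _), integral_const_mul, hBE]
    simp; ring
  have hpp : 0 ≤ ps * (1 - ps) := mul_nonneg hps0.le (by linarith)
  have hv : ps * (1 - ps) * ∑ p, ‖w p‖ ^ 2 ≤ 2 * (ps * (1 - ps)) * specNorm (lap A) := by
    simp only [hw2]
    rw [← Finset.mul_sum]
    have h1 := aux_quad A hAsymm x hx
    rw [Finset.sum_subtype (pairs n) hpairs] at h1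
    have := mul_le_mul_of_nonneg_left h1 hpp
    linarith
  have hbern := aux_bernstein μ ξ hm hi hb h0' _ hq w hw
    (2 * (ps * (1 - ps)) * specNorm (lap A)) ℓ (by positivity) hv hℓ0
  have esq : 2 * (2 * (ps * (1 - ps)) * specNorm (lap A)) * ℓ
      = 4 * ps * (1 - ps) * specNorm (lap A) * ℓ := by ring
  rw [esq] at hbern
  set t := Real.sqrt (4 * ps * (1 - ps) * specNorm (lap A) * ℓ) + 4 / 3 * ℓ with ht
  have hbad : 2 * Real.exp (-ℓ) ≤ η := by
    rw [Real.exp_neg, hℓ, Real.exp_log (by positivity), inv_div]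
    rw [← mul_div_assoc, mul_div_mul_left _ _ (by norm_num : (2 : ℝ) ≠ 0)]
    exact div_le_self hη0.le hn1
  have hbound := hbern.trans hbad
  have hSm : Measurable (fun ω => ∑ i, ξ i ω • w i) :=
    Finset.measurable_sum _ (fun i _ => (hm i).smul_const _)
  set bad := {ω | t ≤ ‖∑ i, ξ i ω • w i‖} with hbaddef
  have hbm : MeasurableSet bad := measurableSet_le measurable_const hSm.norm
  have hsub : badᶜ ⊆ {ω | (ham (thLabels (gcnOut σ h0 h1 x (lap A)) τ)
              (thLabels (gcnOut σ h0 h1 x (lapHat A B ω)) τ) : ℝ)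
          ≤ Real.sqrt n * Cσ * |h1| / γmin *
              ((1 - ps) * specNorm (lap A)
                + Real.sqrt (4 * ps * (1 - ps) * specNorm (lap A) * ℓ)
                + 4 / 3 * ℓ)} := by
    intro ω hω
    have hω' : ‖∑ i, ξ i ω • w i‖ < t := not_le.1 hω
    refine (aux_det (lap A) (lapHat A B ω) σ Cσ hσ h0 h1 x τ γmin hγ hγpos).trans ?_
    refine mul_le_mul_of_nonneg_left ?_ (by positivity)
    have eL : WithLp.toLp 2 ((lap A).mulVec x) = ∑ p, w p := by
      rw [aux_lap_mulVec A hAsymm, Finset.sum_subtype (pairs n) hpairs, WithLp.toLp_sum]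
      rfl
    have eH : WithLp.toLp 2 ((lapHat A B ω).mulVec x) = ∑ p : ι, B p.1.1 p.1.2 ω • w p := by
      rw [lapHat, Matrix.sum_mulVec, Finset.sum_subtype (pairs n) hpairs, WithLp.toLp_sum]
      refine Finset.sum_congr rfl fun p _ => ?_
      rw [Matrix.smul_mulVec, aux_edge_mulVec, smul_smul, WithLp.toLp_smul]
      simp only [w]
      rw [smul_smul]; congr 1; ring
    have e : WithLp.toLp 2 ((lapHat A B ω).mulVec x) - WithLp.toLp 2 ((lap A).mulVec x)
        = ∑ i, ξ i ω • w i - (1 - ps) • WithLp.toLp 2 ((lap A).mulVec x) := by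
      rw [eH, eL]
      simp only [ξ, sub_smul, Finset.sum_sub_distrib, Finset.smul_sum, one_smul]
      abel
    rw [e]
    have h5 := aux_specNorm (lap A) x hx
    have h6 := norm_sub_le (∑ i, ξ i ω • w i) ((1 - ps) • WithLp.toLp 2 ((lap A).mulVec x))
    rw [norm_smul, Real.norm_eq_abs, abs_of_nonneg (by linarith : 0 ≤ 1 - ps)] at h6
    have h7 := mul_le_mul_of_nonneg_left h5 (by linarith : 0 ≤ 1 - ps)
    linarith
  refine le_trans ?_ (measure_mono hsub)
  rw [← ofReal_measureReal, probReal_compl_eq_one_sub hbm]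
  exact ENNReal.ofReal_le_ofReal (by linarith)
end
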